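/- arXiv:1609.04312 — 4 statements merged into one kernel-verified Lean document; each statement's English description precedes it below -/
import Mathlib

section
/- Let (s_a) be nonnegative integers indexed by the atoms a of T0, with 1 ≤ ∑_a s_a ≤ n0 − 1. Define f(T) = |T| · ∏_a C(n^{(a)}(T), s_a) on rooted subtrees T, where C(m,s) is a binomial coefficient, equal to 0 if s > m. Then f is a right eigenfunction of the single-model firing chain with eigenvalue β = (n0 − 1 − ∑_a s_a)/n0: ∑_{T'} K(T,T')·f(T') = β·f(T) for every rooted subtree T. -/
open scoped Classical

noncomputable section

/-- A rooted subtree of the finite rooted-tree poset `V`: a nonempty lower set,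
recorded as a `Finset`. -/
abbrev RSub (V : Type) [PartialOrder V] : Type :=
  {T : Finset V // T.Nonempty ∧ ∀ ⦃a b : V⦄, a ≤ b → b ∈ T → a ∈ T}

/-- `linExt T` : the number of linear extensions of the sub-poset `T`, i.e. of
order-preserving bijections from `T` (with the induced order) to the chain
`{1 < 2 < … < |T|}`. -/
def linExt {V : Type} [PartialOrder V] (T : Finset V) : ℕ :=
  Nat.card {φ : {x // x ∈ T} ≃ Fin T.card //
    ∀ a b : {x // x ∈ T}, (a : V) ≤ (b : V) → (φ a : ℕ) ≤ (φ b : ℕ)}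

/-- The transition matrix of the single-model employee-firing chain on the rooted
subtrees of `V`:  from a state `T` with at least two elements, stay put with probability
`(n₀ - |T|)/n₀`, and move to `T \ {v}` (for `v` a maximal element of `T`) with
probability `(|T|/n₀) ⬝ ℓ(T\{v})/ℓ(T)`;  the singleton root is absorbing. -/
def Kfire {V : Type} [Fintype V] [PartialOrder V] (T T' : RSub V) : ℝ :=
  if 2 ≤ T.1.card then
    if T' = T then ((Fintype.card V : ℝ) - (T.1.card : ℝ)) / (Fintype.card V : ℝ)
    else if ∃ v ∈ T.1, (∀ w ∈ T.1, v ≤ w → w = v) ∧ T'.1 = T.1.erase v then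
      ((T.1.card : ℝ) / (Fintype.card V : ℝ)) * (linExt T'.1 : ℝ) / (linExt T.1 : ℝ)
    else 0
  else if T' = T then 1 else 0

/-- `Kfire` as a square matrix indexed by the rooted subtrees of `V`. -/
def KfireM (V : Type) [Fintype V] [PartialOrder V] : Matrix (RSub V) (RSub V) ℝ :=
  Matrix.of fun T T' => Kfire T T'


/-- Linear extensions of `T`, encoded as functions on the ambient type vanishing off `T`. -/
def labelings {V : Type} [PartialOrder V] (T : Finset V) : Set (V → ℕ) :=
  {f | (∀ x ∉ T, f x = 0) ∧ Set.BijOn f T (Set.Iio T.card) ∧ MonotoneOn f T}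

/-- The maximal elements of a finset. -/
def maxs {V : Type} [PartialOrder V] (T : Finset V) : Finset V :=
  T.filter fun v => ∀ w ∈ T, v ≤ w → w = v

theorem mem_maxs {V : Type} [PartialOrder V] {T : Finset V} {v : V} :
    v ∈ maxs T ↔ v ∈ T ∧ ∀ w ∈ T, v ≤ w → w = v := by
  simp [maxs]

theorem nonempty_equiv_labelings {V : Type} [PartialOrder V] (T : Finset V) :
    Nonempty ({φ : {x // x ∈ T} ≃ Fin T.card //
      ∀ a b : {x // x ∈ T}, (a : V) ≤ (b : V) → (φ a : ℕ) ≤ (φ b : ℕ)} ≃ labelings T) := by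
  refine ⟨Equiv.ofBijective (fun φ => ⟨fun x => if h : x ∈ T then (φ.1 ⟨x, h⟩ : ℕ) else 0,
    fun x hx => by simp [hx], ⟨?_, ?_, ?_⟩, ?_⟩) ⟨?_, ?_⟩⟩
  · intro x hx
    have hx' : x ∈ T := hx
    simp [hx']
  · intro x hx y hy hxy
    have hx' : x ∈ T := hx
    have hy' : y ∈ T := hy
    simp only [hx', hy', dif_pos] at hxy
    simpa using φ.1.injective (Fin.ext hxy)
  · intro i hi
    refine ⟨φ.1.symm ⟨i, hi⟩, (φ.1.symm ⟨i, hi⟩).2, ?_⟩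
    simp
  · intro x hx y hy hxy
    have hx' : x ∈ T := hx
    have hy' : y ∈ T := hy
    simp only [hx', hy', dif_pos]
    exact φ.2 _ _ hxy
  · intro φ ψ h
    apply Subtype.ext
    ext ⟨x, hx⟩
    have := congrFun (congrArg Subtype.val h) x
    simpa [hx] using this
  · rintro ⟨f, h0, hb, hm⟩
    refine ⟨⟨Equiv.ofBijective (fun x => ⟨f x.1, hb.mapsTo x.2⟩) ⟨?_, ?_⟩, ?_⟩, ?_⟩
    · rintro ⟨x, hx⟩ ⟨y, hy⟩ hxy
      exact Subtype.ext (hb.injOn hx hy (congrArg Fin.val hxy))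
    · rintro ⟨i, hi⟩
      obtain ⟨x, hx, hxi⟩ := hb.surjOn hi
      exact ⟨⟨x, hx⟩, Fin.ext hxi⟩
    · rintro ⟨x, hx⟩ ⟨y, hy⟩ hxy
      exact hm hx hy hxy
    · apply Subtype.ext
      funext x
      by_cases hx : x ∈ T
      · simp only [hx, dif_pos]
        rfl
      · simp [hx, h0 x hx]

theorem linExt_eq_ncard {V : Type} [PartialOrder V] (T : Finset V) :
    linExt T = (labelings T).ncard :=
  Nat.card_congr (nonempty_equiv_labelings T).some

theorem finite_labelings {V : Type} [PartialOrder V] (T : Finset V) : (labelings T).Finite :=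
  Set.finite_coe_iff.1 (Finite.of_equiv _ (nonempty_equiv_labelings T).some)

theorem ncard_labelings_last {V : Type} [PartialOrder V] {T : Finset V} {v : V}
    (hv : v ∈ maxs T) :
    {f ∈ labelings T | f v = T.card - 1}.ncard = (labelings (T.erase v)).ncard := by
  obtain ⟨hvT, hmax⟩ := mem_maxs.1 hv
  have hpos : 0 < T.card := Finset.card_pos.2 ⟨v, hvT⟩
  have hcard : (T.erase v).card = T.card - 1 := Finset.card_erase_of_mem hvT
  refine Set.ncard_congr (fun f _ => Function.update f v 0) ?_ ?_ ?_
  · rintro f ⟨⟨h0, hb, hm⟩, hfv⟩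
    refine ⟨fun x hx => ?_, ⟨fun x hx => ?_, fun x hx y hy hxy => ?_, fun i hi => ?_⟩,
      fun x hx y hy hxy => ?_⟩
    · by_cases h : x = v
      · simp [h]
      · rw [Function.update_of_ne h]
        exact h0 x fun hxT => hx (Finset.mem_erase.2 ⟨h, hxT⟩)
    · obtain ⟨hne, hxT⟩ := Finset.mem_erase.1 hx
      rw [Function.update_of_ne hne]
      have h1 : f x < T.card := hb.mapsTo hxT
      have h2 : f x ≠ f v := fun h => hne (hb.injOn hxT hvT h)
      simp only [Set.mem_Iio]
      omega
    · obtain ⟨hne, hxT⟩ := Finset.mem_erase.1 hx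
      obtain ⟨hne', hyT⟩ := Finset.mem_erase.1 hy
      simp only [Function.update_of_ne hne, Function.update_of_ne hne'] at hxy
      exact hb.injOn hxT hyT hxy
    · simp only [Set.mem_Iio] at hi
      obtain ⟨x, hxT, hxi⟩ := hb.surjOn (show i ∈ Set.Iio T.card by simp only [Set.mem_Iio]; omega)
      have hne : x ≠ v := by
        rintro rfl
        omega
      exact ⟨x, Finset.mem_coe.2 (Finset.mem_erase.2 ⟨hne, hxT⟩), by
        rw [Function.update_of_ne hne, hxi]⟩
    · obtain ⟨hne, hxT⟩ := Finset.mem_erase.1 hx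
      obtain ⟨hne', hyT⟩ := Finset.mem_erase.1 hy
      simp only [Function.update_of_ne hne, Function.update_of_ne hne']
      exact hm hxT hyT hxy
  · rintro f g ⟨-, hf⟩ ⟨-, hg⟩ h
    funext x
    by_cases hx : x = v
    · rw [hx, hf, hg]
    · simpa [Function.update_of_ne hx] using congrFun h x
  · rintro g ⟨h0, hb, hm⟩
    have hgv : g v = 0 := h0 v (by simp)
    have hlt : ∀ x ∈ T, x ≠ v → g x < T.card - 1 := fun x hx hne => by
      have : g x < (T.erase v).card :=
        hb.mapsTo (Finset.mem_coe.2 (Finset.mem_erase.2 ⟨hne, hx⟩))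
      omega
    refine ⟨Function.update g v (T.card - 1), ⟨⟨fun x hx => ?_, ⟨fun x hx => ?_,
      fun x hx y hy hxy => ?_, fun i hi => ?_⟩, fun x hx y hy hxy => ?_⟩, by simp⟩, ?_⟩
    · have hne : x ≠ v := fun h => hx (h ▸ hvT)
      rw [Function.update_of_ne hne]
      exact h0 x fun h => hx (Finset.mem_of_mem_erase h)
    · by_cases h : x = v
      · subst h
        simp only [Function.update_self, Set.mem_Iio]
        omega
      · have := hlt x hx h
        simp only [Function.update_of_ne h, Set.mem_Iio]
        omega
    · by_cases h : x = v <;> by_cases h' : y = v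
      · rw [h, h']
      · have := hlt y hy h'
        simp only [h, Function.update_self, Function.update_of_ne h'] at hxy
        omega
      · have := hlt x hx h
        simp only [h', Function.update_self, Function.update_of_ne h] at hxy
        omega
      · simp only [Function.update_of_ne h, Function.update_of_ne h'] at hxy
        exact hb.injOn (Finset.mem_coe.2 (Finset.mem_erase.2 ⟨h, hx⟩))
          (Finset.mem_coe.2 (Finset.mem_erase.2 ⟨h', hy⟩)) hxy
    · by_cases h : i = T.card - 1
      · exact ⟨v, hvT, by simp [h]⟩
      · simp only [Set.mem_Iio] at hi
        obtain ⟨x, hx, hxi⟩ := hb.surjOn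
          (show i ∈ Set.Iio (T.erase v).card by simp only [Set.mem_Iio]; omega)
        obtain ⟨hne, hxT⟩ := Finset.mem_erase.1 hx
        exact ⟨x, hxT, by rw [Function.update_of_ne hne, hxi]⟩
    · by_cases h : x = v
      · subst h
        rw [hmax y hy hxy]
      · by_cases h' : y = v
        · have := hlt x hx h
          simp only [h', Function.update_self, Function.update_of_ne h]
          omega
        · simp only [Function.update_of_ne h, Function.update_of_ne h']
          exact hm (Finset.mem_coe.2 (Finset.mem_erase.2 ⟨h, hx⟩))
            (Finset.mem_coe.2 (Finset.mem_erase.2 ⟨h', hy⟩)) hxy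
    · simp [← hgv]

/-- Removing the top element of a linear extension. -/
theorem linExt_eq_sum_erase {V : Type} [PartialOrder V] {T : Finset V} (hT : T.Nonempty) :
    linExt T = ∑ v ∈ maxs T, linExt (T.erase v) := by
  have hpos : 0 < T.card := Finset.card_pos.2 hT
  set E := (finite_labelings T).toFinset with hE
  have hmem : ∀ f, f ∈ E ↔ f ∈ labelings T := fun f => by simp [hE]
  have hU : E = (maxs T).biUnion fun v => E.filter fun f => f v = T.card - 1 := by
    ext f
    simp only [Finset.mem_biUnion, Finset.mem_filter]
    refine ⟨fun hf => ?_, fun ⟨_, _, h, _⟩ => h⟩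
    obtain ⟨h0, hb, hm⟩ := (hmem f).1 hf
    obtain ⟨v, hvT, hv⟩ := hb.surjOn
      (show T.card - 1 ∈ Set.Iio T.card by simp only [Set.mem_Iio]; omega)
    refine ⟨v, mem_maxs.2 ⟨hvT, fun w hw hvw => ?_⟩, hf, hv⟩
    have h1 : f v ≤ f w := hm hvT hw hvw
    have h2 : f w < T.card := hb.mapsTo hw
    exact hb.injOn hw hvT (by omega)
  have hdisj : (maxs T : Set V).PairwiseDisjoint fun v => E.filter fun f => f v = T.card - 1 := by
    intro v hv w hw hne
    refine Finset.disjoint_left.2 fun f hf hf' => hne ?_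
    simp only [Finset.mem_filter] at hf hf'
    exact ((hmem f).1 hf.1).2.1.injOn (mem_maxs.1 hv).1 (mem_maxs.1 hw).1
      (hf.2.trans hf'.2.symm)
  rw [linExt_eq_ncard, Set.ncard_eq_toFinset_card _ (finite_labelings T), ← hE, hU,
    Finset.card_biUnion hdisj]
  refine Finset.sum_congr rfl fun v hv => ?_
  rw [linExt_eq_ncard, ← ncard_labelings_last hv, ← Set.ncard_coe_finset]
  congr 1
  ext f
  simp [hmem]

theorem maxs_nonempty {V : Type} [PartialOrder V] {T : Finset V} (hT : T.Nonempty) :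
    (maxs T).Nonempty := by
  obtain ⟨v, hv⟩ := T.exists_maximal hT
  exact ⟨v, mem_maxs.2 ⟨hv.prop, fun w hw hvw => le_antisymm (hv.le_of_ge hw hvw) hvw⟩⟩

theorem linExt_pos {V : Type} [PartialOrder V] (T : Finset V) : 0 < linExt T := by
  induction T using Finset.strongInduction with
  | _ T ih =>
    rcases T.eq_empty_or_nonempty with rfl | hT
    · rw [linExt_eq_ncard, Set.ncard_pos (finite_labelings ∅)]
      exact ⟨fun _ => 0, by simp [labelings, MonotoneOn]⟩
    · rw [linExt_eq_sum_erase hT]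
      exact Finset.sum_pos (fun v hv => ih _ (Finset.erase_ssubset (mem_maxs.1 hv).1))
        (maxs_nonempty hT)

/-- The number of linear extensions of `T` whose top element lies above `a`. -/
def linExtTop {V : Type} [PartialOrder V] (a : V) (T : Finset V) : ℕ :=
  ∑ v ∈ (maxs T).filter (a ≤ ·), linExt (T.erase v)

/-- The number of elements of `T` above `a`. -/
def above {V : Type} [PartialOrder V] (a : V) (T : Finset V) : ℕ :=
  (T.filter (a ≤ ·)).card

theorem not_le_le_of_atoms {V : Type} [PartialOrder V] [OrderBot V]
    (htree : ∀ v a b : V, a ≤ v → b ≤ v → a ≤ b ∨ b ≤ a) {a b : V} (ha : IsAtom a)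
    (hb : IsAtom b) (hab : a ≠ b) {v : V} (hav : a ≤ v) : ¬ b ≤ v := fun hbv => by
  rcases htree v a b hav hbv with h | h
  · exact hab (((hb.le_iff.1 h).resolve_left ha.1))
  · exact hab (((ha.le_iff.1 h).resolve_left hb.1)).symm

theorem filter_maxs_erase {V : Type} [PartialOrder V] [OrderBot V]
    (htree : ∀ v a b : V, a ≤ v → b ≤ v → a ≤ b ∨ b ≤ a) {a b : V} (ha : IsAtom a)
    (hb : IsAtom b) (hab : a ≠ b) {T : Finset V} {v : V} (hav : a ≤ v) :
    (maxs (T.erase v)).filter (b ≤ ·) = (maxs T).filter (b ≤ ·) := by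
  ext u
  simp only [Finset.mem_filter, mem_maxs, Finset.mem_erase]
  constructor
  · rintro ⟨⟨⟨hne, huT⟩, hmax⟩, hbu⟩
    refine ⟨⟨huT, fun w hw huw => hmax w ⟨?_, hw⟩ huw⟩, hbu⟩
    rintro rfl
    exact not_le_le_of_atoms htree ha hb hab hav (hbu.trans huw)
  · rintro ⟨⟨huT, hmax⟩, hbu⟩
    refine ⟨⟨⟨?_, huT⟩, fun w hw huw => hmax w hw.2 huw⟩, hbu⟩
    rintro rfl
    exact not_le_le_of_atoms htree ha hb hab hav hbu

theorem sum_linExtTop_erase_comm {V : Type} [PartialOrder V] [OrderBot V]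
    (htree : ∀ v a b : V, a ≤ v → b ≤ v → a ≤ b ∨ b ≤ a) {a b : V} (ha : IsAtom a)
    (hb : IsAtom b) (hab : a ≠ b) (T : Finset V) :
    ∑ v ∈ (maxs T).filter (a ≤ ·), linExtTop b (T.erase v) =
      ∑ u ∈ (maxs T).filter (b ≤ ·), linExtTop a (T.erase u) := by
  have key : ∀ {a b : V}, IsAtom a → IsAtom b → a ≠ b →
      ∑ v ∈ (maxs T).filter (a ≤ ·), linExtTop b (T.erase v) =
      ∑ v ∈ (maxs T).filter (a ≤ ·), ∑ u ∈ (maxs T).filter (b ≤ ·),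
        linExt ((T.erase v).erase u) := fun ha hb hab =>
    Finset.sum_congr rfl fun v hv => by
      rw [linExtTop, filter_maxs_erase htree ha hb hab (Finset.mem_filter.1 hv).2]
  rw [key ha hb hab, key hb ha hab.symm, Finset.sum_comm]
  simp only [Finset.erase_right_comm]

theorem above_erase_of_not_le {V : Type} [PartialOrder V] {b v : V} (T : Finset V)
    (h : ¬ b ≤ v) : above b (T.erase v) = above b T := by
  rw [above, Finset.filter_erase, Finset.erase_eq_of_notMem (by simp [h]), above]

theorem above_erase_of_le {V : Type} [PartialOrder V] {b v : V} {T : Finset V}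
    (hv : v ∈ T) (h : b ≤ v) : above b (T.erase v) = above b T - 1 := by
  rw [above, Finset.filter_erase, Finset.card_erase_of_mem (by simp [h, hv]), above]

/-- Every non-root element lies above exactly one atom. -/
theorem sum_eq_sum_atoms {V : Type} [Fintype V] [PartialOrder V] [OrderBot V]
    (htree : ∀ v a b : V, a ≤ v → b ≤ v → a ≤ b ∨ b ≤ a) {M : Type*} [AddCommMonoid M]
    {S : Finset V} (hS : ⊥ ∉ S) (g : V → M) :
    ∑ v ∈ S, g v = ∑ a ∈ Finset.univ.filter (fun a : V => IsAtom a),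
      ∑ v ∈ S.filter (a ≤ ·), g v := by
  simp only [Finset.sum_filter (s := S)]
  rw [Finset.sum_comm]
  refine Finset.sum_congr rfl fun v hv => ?_
  obtain ⟨a, ha, hav⟩ := (eq_bot_or_exists_atom_le v).resolve_left (fun h => hS (h ▸ hv))
  rw [Finset.sum_eq_single a, if_pos hav]
  · intro b hb hne
    exact if_neg (not_le_le_of_atoms htree ha (Finset.mem_filter.1 hb).2 hne.symm hav)
  · intro h
    exact absurd (by simp [ha]) h

theorem sum_above {V : Type} [Fintype V] [PartialOrder V] [OrderBot V]
    (htree : ∀ v a b : V, a ≤ v → b ≤ v → a ≤ b ∨ b ≤ a) {T : Finset V} (hT : ⊥ ∈ T) :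
    ∑ a ∈ Finset.univ.filter (fun a : V => IsAtom a), above a T = T.card - 1 := by
  rw [← Finset.card_erase_of_mem hT, Finset.card_eq_sum_ones,
    sum_eq_sum_atoms htree (Finset.notMem_erase ⊥ T)]
  refine Finset.sum_congr rfl fun a ha => ?_
  have hbot : ¬ a ≤ ⊥ := fun h => (Finset.mem_filter.1 ha).2.1 (le_bot_iff.1 h)
  rw [← Finset.card_eq_sum_ones, ← above_erase_of_not_le T hbot, above]

theorem bot_notMem_maxs {V : Type} [PartialOrder V] [OrderBot V] {T : Finset V}
    (hT : 2 ≤ T.card) : ⊥ ∉ maxs T := fun h => by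
  have : T ⊆ {⊥} := fun w hw => Finset.mem_singleton.2 ((mem_maxs.1 h).2 w hw bot_le)
  have := Finset.card_le_card this
  simp at this
  omega

theorem sum_linExtTop {V : Type} [Fintype V] [PartialOrder V] [OrderBot V]
    (htree : ∀ v a b : V, a ≤ v → b ≤ v → a ≤ b ∨ b ≤ a) {T : Finset V} (hT : 2 ≤ T.card) :
    ∑ a ∈ Finset.univ.filter (fun a : V => IsAtom a), linExtTop a T = linExt T := by
  rw [linExt_eq_sum_erase (Finset.card_pos.1 (by omega)),
    sum_eq_sum_atoms htree (bot_notMem_maxs hT)]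
  rfl

theorem linExtTop_eq_zero {V : Type} [PartialOrder V] {a : V} {T : Finset V}
    (h : above a T = 0) : linExtTop a T = 0 := by
  rw [linExtTop, Finset.sum_eq_zero]
  intro v hv
  obtain ⟨hv, hav⟩ := Finset.mem_filter.1 hv
  have : v ∈ T.filter (a ≤ ·) := Finset.mem_filter.2 ⟨(mem_maxs.1 hv).1, hav⟩
  rw [Finset.card_eq_zero.1 h] at this
  simp at this

/-- The top element of a uniform linear extension of `T` lies above the atom `a` with
probability proportional to the number of elements above `a`. -/
theorem card_sub_one_mul_linExtTop {V : Type} [Fintype V] [PartialOrder V] [OrderBot V]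
    (htree : ∀ v a b : V, a ≤ v → b ≤ v → a ≤ b ∨ b ≤ a) {a : V} (ha : IsAtom a)
    (T : Finset V) (hbot : ⊥ ∈ T) (hT : 2 ≤ T.card) :
    (T.card - 1) * linExtTop a T = above a T * linExt T := by
  induction T using Finset.strongInduction generalizing a with
  | _ T ih =>
    have hsymm : ∀ b, IsAtom b → above b T * linExtTop a T = above a T * linExtTop b T := by
      intro b hb
      by_cases hab : a = b
      · rw [hab]
      rcases hT.eq_or_lt with h2 | h3
      · have hle : above a T + above b T ≤ 1 := by
          have h := sum_above htree hbot
          have h' : ∑ c ∈ {a, b}, above c T ≤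
              ∑ c ∈ Finset.univ.filter (fun c : V => IsAtom c), above c T :=
            Finset.sum_le_sum_of_subset (by
              intro c hc
              simp only [Finset.mem_insert, Finset.mem_singleton] at hc
              rcases hc with rfl | rfl <;> simp [ha, hb])
          rw [Finset.sum_pair hab] at h'
          omega
        rcases Nat.eq_zero_or_pos (above a T) with h | h
        · rw [h, linExtTop_eq_zero h]
          simp
        · have h : above b T = 0 := by omega
          rw [h, linExtTop_eq_zero h]
          simp
      · have key : ∀ {a b : V}, IsAtom a → IsAtom b → a ≠ b → (T.card - 2) *
            ∑ v ∈ (maxs T).filter (a ≤ ·), linExtTop b (T.erase v) =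
              above b T * linExtTop a T := by
          intro a b ha hb hab
          rw [linExtTop, Finset.mul_sum, Finset.mul_sum]
          refine Finset.sum_congr rfl fun v hv => ?_
          obtain ⟨hv, hav⟩ := Finset.mem_filter.1 hv
          have hvT := (mem_maxs.1 hv).1
          have hc : (T.erase v).card = T.card - 1 := Finset.card_erase_of_mem hvT
          have hvb : ⊥ ≠ v := fun h => bot_notMem_maxs hT (h ▸ hv)
          have := ih _ (Finset.erase_ssubset hvT) hb (Finset.mem_erase.2 ⟨hvb, hbot⟩)
            (by omega)
          rwa [above_erase_of_not_le T (not_le_le_of_atoms htree ha hb hab hav), hc,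
            Nat.sub_sub] at this
        rw [← key ha hb hab, ← key hb ha (Ne.symm hab), sum_linExtTop_erase_comm htree ha hb hab]
    rw [← sum_above htree hbot, ← sum_linExtTop htree hT, Finset.sum_mul, Finset.mul_sum]
    exact Finset.sum_congr rfl fun b hb => hsymm b (Finset.mem_filter.1 hb).2

/-- Expansion of one step of the chain as a sum over the maximal elements. -/
theorem sum_Kfire {V : Type} [Fintype V] [PartialOrder V] [OrderBot V] (T : RSub V)
    (hT : 2 ≤ T.1.card) (F : Finset V → ℝ) :
    ∑ T' : RSub V, Kfire T T' * F T'.1 =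
      ((Fintype.card V : ℝ) - (T.1.card : ℝ)) / (Fintype.card V : ℝ) * F T.1 +
        ((T.1.card : ℝ) / (Fintype.card V : ℝ)) / (linExt T.1 : ℝ) *
          ∑ v ∈ maxs T.1, (linExt (T.1.erase v) : ℝ) * F (T.1.erase v) := by
  have hstep : ∀ T' : RSub V, Kfire T T' * F T'.1 =
      (if T' = T then
        ((Fintype.card V : ℝ) - (T.1.card : ℝ)) / (Fintype.card V : ℝ) * F T.1 else 0) +
      ∑ v ∈ maxs T.1, if T'.1 = T.1.erase v then
        ((T.1.card : ℝ) / (Fintype.card V : ℝ)) / (linExt T.1 : ℝ) *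
          ((linExt (T.1.erase v) : ℝ) * F (T.1.erase v)) else 0 := by
    intro T'
    rw [Kfire, if_pos hT]
    by_cases h : T' = T
    · rw [if_pos h, if_pos h, Finset.sum_eq_zero, h, add_zero]
      intro v hv
      refine if_neg fun he => ?_
      have := he ▸ (h ▸ (mem_maxs.1 hv).1 : v ∈ T'.1)
      simp at this
    · rw [if_neg h, if_neg h, zero_add]
      by_cases hex : ∃ v ∈ T.1, (∀ w ∈ T.1, v ≤ w → w = v) ∧ T'.1 = T.1.erase v
      · rw [if_pos hex]
        obtain ⟨v, hv, hm, he⟩ := hex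
        rw [Finset.sum_eq_single v, if_pos he, he]
        · ring
        · intro w hw hne
          refine if_neg fun he' => hne ?_
          exact (Finset.erase_inj T.1 (mem_maxs.1 hw).1).1 (he'.symm.trans he)
        · intro h
          exact absurd (mem_maxs.2 ⟨hv, hm⟩) h
      · rw [if_neg hex, zero_mul, Finset.sum_eq_zero]
        intro v hv
        exact if_neg fun he => hex ⟨v, (mem_maxs.1 hv).1, (mem_maxs.1 hv).2, he⟩
  simp only [hstep]
  rw [Finset.sum_add_distrib, Finset.sum_ite_eq' Finset.univ T, if_pos (Finset.mem_univ _),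
    Finset.sum_comm, Finset.mul_sum]
  congr 1
  refine Finset.sum_congr rfl fun v hv => ?_
  obtain ⟨hvT, hmax⟩ := mem_maxs.1 hv
  have hne : (T.1.erase v).Nonempty := Finset.card_pos.1 (by
    rw [Finset.card_erase_of_mem hvT]
    omega)
  have hlow : ∀ ⦃a b : V⦄, a ≤ b → b ∈ T.1.erase v → a ∈ T.1.erase v := by
    intro a b hab hb
    obtain ⟨hbv, hbT⟩ := Finset.mem_erase.1 hb
    refine Finset.mem_erase.2 ⟨?_, T.2.2 hab hbT⟩
    rintro rfl
    exact hbv (hmax b hbT hab)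
  rw [Finset.sum_eq_single (⟨T.1.erase v, hne, hlow⟩ : RSub V), if_pos rfl]
  · intro T' _ hT'
    exact if_neg fun he => hT' (Subtype.ext he)
  · intro h
    exact absurd (Finset.mem_univ _) h

theorem mul_choose_pred (m s : ℕ) :
    (m : ℝ) * ((m - 1).choose s : ℝ) = ((m : ℝ) - s) * (m.choose s : ℝ) := by
  rcases m with _ | m
  · rcases s with _ | s <;> simp
  · rcases Nat.lt_or_ge (m + 1) s with h | h
    · rw [Nat.choose_eq_zero_of_lt h, Nat.choose_eq_zero_of_lt (by omega)]
      simp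
    · have := Nat.choose_mul_succ_eq m s
      rw [Nat.add_sub_cancel, ← Nat.cast_sub h]
      exact_mod_cast (by linarith : (m + 1) * m.choose s = (m + 1 - s) * (m + 1).choose s)

theorem sum_linExt_mul_prod_choose {V : Type} [Fintype V] [PartialOrder V] [OrderBot V]
    (htree : ∀ v a b : V, a ≤ v → b ≤ v → a ≤ b ∨ b ≤ a) (s : V → ℕ) {T : Finset V}
    (hbot : ⊥ ∈ T) (hT : 2 ≤ T.card) :
    ∑ v ∈ maxs T, (linExt (T.erase v) : ℝ) * (((T.erase v).card : ℝ) *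
        ∏ a ∈ Finset.univ.filter (fun a : V => IsAtom a),
          ((above a (T.erase v)).choose (s a) : ℝ)) =
      (linExt T : ℝ) * (((T.card : ℝ) - 1 -
        ((∑ a ∈ Finset.univ.filter (fun a : V => IsAtom a), s a : ℕ) : ℝ)) *
        ∏ a ∈ Finset.univ.filter (fun a : V => IsAtom a), ((above a T).choose (s a) : ℝ)) := by
  have hsum : ((T.card : ℝ) - 1 -
        ((∑ a ∈ Finset.univ.filter (fun a : V => IsAtom a), s a : ℕ) : ℝ)) =
      ∑ a ∈ Finset.univ.filter (fun a : V => IsAtom a), ((above a T : ℝ) - s a) := by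
    rw [Finset.sum_sub_distrib, ← Nat.cast_sum, sum_above htree hbot,
      Nat.cast_sub (by omega), Nat.cast_sum, Nat.cast_one]
  rw [sum_eq_sum_atoms htree (bot_notMem_maxs hT), hsum, Finset.sum_mul, Finset.mul_sum]
  refine Finset.sum_congr rfl fun a ha => ?_
  have ha' : IsAtom a := (Finset.mem_filter.1 ha).2
  set R : ℝ := ∏ b ∈ (Finset.univ.filter (fun b : V => IsAtom b)).erase a,
    ((above b T).choose (s b) : ℝ) with hR
  have hterm : ∀ v ∈ (maxs T).filter (a ≤ ·),
      (linExt (T.erase v) : ℝ) * (((T.erase v).card : ℝ) *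
        ∏ b ∈ Finset.univ.filter (fun b : V => IsAtom b),
          ((above b (T.erase v)).choose (s b) : ℝ)) =
      (linExt (T.erase v) : ℝ) *
        (((T.card - 1 : ℕ) : ℝ) * (((above a T - 1).choose (s a) : ℝ) * R)) := by
    intro v hv
    obtain ⟨hv, hav⟩ := Finset.mem_filter.1 hv
    have hvT := (mem_maxs.1 hv).1
    rw [Finset.card_erase_of_mem hvT, ← Finset.mul_prod_erase _ _ ha,
      above_erase_of_le hvT hav, hR]
    congr 3
    refine Finset.prod_congr rfl fun b hb => ?_
    obtain ⟨hba, hb⟩ := Finset.mem_erase.1 hb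
    rw [above_erase_of_not_le T
      (not_le_le_of_atoms htree ha' (Finset.mem_filter.1 hb).2 hba.symm hav)]
  have hL : ((T.card - 1 : ℕ) : ℝ) * ∑ v ∈ (maxs T).filter (a ≤ ·), (linExt (T.erase v) : ℝ) =
      above a T * linExt T := by
    exact_mod_cast card_sub_one_mul_linExtTop htree ha' T hbot hT
  rw [Finset.sum_congr rfl hterm, ← Finset.sum_mul, ← Finset.mul_prod_erase _ _ ha, ← hR]
  linear_combination ((above a T - 1).choose (s a) : ℝ) * R * hL +
    (linExt T : ℝ) * R * mul_choose_pred (above a T) (s a)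

/-- **Department-team right eigenfunctions.**  Let `(s a)` be nonnegative integers
indexed by the atoms `a` of `V` (the elements covering the root) with
`1 ≤ ∑ s a ≤ n₀ - 1`.  Then `f(T) = |T| ⬝ ∏_a C(n⁽ᵃ⁾(T), s a)` — where
`n⁽ᵃ⁾(T) = #{w ∈ T : a ≤ w}` — is a right eigenfunction of the single-model firing chain
with eigenvalue `(n₀ - 1 - ∑ s a)/n₀`. -/
theorem firing_chain_department_eigenfunction
    (V : Type) [Fintype V] [PartialOrder V] [OrderBot V]
    (htree : ∀ v a b : V, a ≤ v → b ≤ v → a ≤ b ∨ b ≤ a)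
    (s : V → ℕ)
    (hS1 : 1 ≤ ∑ a ∈ Finset.univ.filter (fun a : V => IsAtom a), s a)
    (hS2 : (∑ a ∈ Finset.univ.filter (fun a : V => IsAtom a), s a) ≤ Fintype.card V - 1)
    (T : RSub V) :
    ∑ T' : RSub V, Kfire T T' *
        ((T'.1.card : ℝ) * ∏ a ∈ Finset.univ.filter (fun a : V => IsAtom a),
          ((T'.1.filter (fun w => a ≤ w)).card.choose (s a) : ℝ))
      = (((Fintype.card V : ℝ) - 1 -
            ((∑ a ∈ Finset.univ.filter (fun a : V => IsAtom a), s a : ℕ) : ℝ)) /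
          (Fintype.card V : ℝ)) *
        ((T.1.card : ℝ) * ∏ a ∈ Finset.univ.filter (fun a : V => IsAtom a),
          ((T.1.filter (fun w => a ≤ w)).card.choose (s a) : ℝ)) := by
  obtain ⟨x, hx⟩ := T.2.1
  have hbot : ⊥ ∈ T.1 := T.2.2 bot_le hx
  have hn : (Fintype.card V : ℝ) ≠ 0 := by
    exact_mod_cast (Fintype.card_pos_iff.2 ⟨x⟩).ne'
  by_cases hT : 2 ≤ T.1.card
  · rw [sum_Kfire T hT fun S => (S.card : ℝ) *
      ∏ a ∈ Finset.univ.filter (fun a : V => IsAtom a),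
        ((S.filter (fun w => a ≤ w)).card.choose (s a) : ℝ)]
    have h := sum_linExt_mul_prod_choose htree s hbot hT
    simp only [above] at h
    rw [h]
    have hl : (linExt T.1 : ℝ) ≠ 0 := by exact_mod_cast (linExt_pos T.1).ne'
    field_simp
    ring
  · have hTbot : T.1 = {⊥} := by
      have := Finset.card_pos.2 T.2.1
      obtain ⟨y, hy⟩ := Finset.card_eq_one.1 (by omega : T.1.card = 1)
      rw [hy] at hbot ⊢
      rw [Finset.mem_singleton.1 hbot]
    have hprod : ∏ a ∈ Finset.univ.filter (fun a : V => IsAtom a),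
        ((T.1.filter (fun w => a ≤ w)).card.choose (s a) : ℝ) = 0 := by
      obtain ⟨a, ha, hsa⟩ := Finset.exists_ne_zero_of_sum_ne_zero (Nat.one_le_iff_ne_zero.1 hS1)
      refine Finset.prod_eq_zero ha ?_
      have hab : ¬ a ≤ ⊥ := fun h => (Finset.mem_filter.1 ha).2.1 (le_bot_iff.1 h)
      rw [hTbot, Finset.filter_singleton, if_neg hab, Finset.card_empty,
        Nat.choose_eq_zero_of_lt (Nat.pos_of_ne_zero hsa), Nat.cast_zero]
    rw [hprod, mul_zero, mul_zero]
    refine Finset.sum_eq_zero fun T' _ => ?_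
    rw [Kfire, if_neg hT]
    by_cases h : T' = T
    · rw [h, hprod]
      simp
    · rw [if_neg h, zero_mul]

end
end

section
/- Let x be a finite rooted-forest poset with n elements. Then for every integer 0 ≤ i ≤ n, the binomial coefficient C(n,i) equals ∑_S ∏_{v∈S} h_x(v)/h_S(v), where the sum runs over all lower sets S of x with |S| = i (the empty lower set contributing the empty product 1 when i = 0). -/
open scoped Classical

noncomputable section

/-- The hook length of `v` in the finite set `F`: the number of elements of `F` above `v`. -/
def hookLength {α : Type*} [PartialOrder α] (F : Finset α) (v : α) : ℕ :=
  (F.filter (fun w => v ≤ w)).card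

/-- The subsets of `F` with `i` elements that are lower sets relative to `F`. -/
def lowerSubsets {α : Type*} [PartialOrder α] (F : Finset α) (i : ℕ) : Finset (Finset α) :=
  (F.powersetCard i).filter (fun S => ∀ a ∈ F, ∀ b ∈ S, a ≤ b → a ∈ S)

/-- The sum over lower subsets `S` of `F` of size `i` of the products of hook length ratios. -/
def hookSum {α : Type*} [PartialOrder α] (F : Finset α) (i : ℕ) : ℝ :=
  ∑ S ∈ lowerSubsets F i, ∏ v ∈ S, (hookLength F v : ℝ) / (hookLength S v : ℝ)

section

variable {α : Type*} [PartialOrder α]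

lemma mem_lowerSubsets {F S : Finset α} {i : ℕ} :
    S ∈ lowerSubsets F i ↔
      (S ⊆ F ∧ S.card = i) ∧ ∀ a ∈ F, ∀ b ∈ S, a ≤ b → a ∈ S := by
  simp [lowerSubsets, Finset.mem_powersetCard]

lemma hookSum_zero (F : Finset α) : hookSum F 0 = 1 := by
  have h : lowerSubsets F 0 = {∅} := by
    ext S
    simp only [mem_lowerSubsets, Finset.card_eq_zero, Finset.mem_singleton]
    constructor
    · rintro ⟨⟨_, h⟩, _⟩
      exact h
    · rintro rfl
      simp
  simp [hookSum, h]

lemma hookLength_union_left {A B : Finset α} {v : α} (h : ∀ b ∈ B, ¬ v ≤ b) :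
    hookLength (A ∪ B) v = hookLength A v := by
  simp only [hookLength, Finset.filter_union, Finset.filter_false_of_mem h, Finset.union_empty]

lemma hookLength_union_right {A B : Finset α} {v : α} (h : ∀ a ∈ A, ¬ v ≤ a) :
    hookLength (A ∪ B) v = hookLength B v := by
  rw [Finset.union_comm, hookLength_union_left h]

lemma hookLength_eq_card {A : Finset α} {v : α} (h : ∀ a ∈ A, v ≤ a) :
    hookLength A v = A.card := by
  rw [hookLength, Finset.filter_true_of_mem h]

/-- Hook sums satisfy the Vandermonde convolution for unions without relations. -/
lemma hookSum_union {A B : Finset α} (hAB : ∀ a ∈ A, ∀ b ∈ B, ¬ a ≤ b ∧ ¬ b ≤ a) (k : ℕ) :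
    hookSum (A ∪ B) k = ∑ p ∈ Finset.HasAntidiagonal.antidiagonal k, hookSum A p.1 * hookSum B p.2 := by
  have hdisj : Disjoint A B := Finset.disjoint_left.2 fun a ha hb => (hAB a ha a hb).1 le_rfl
  have hcard : ∀ S ⊆ A ∪ B, (S ∩ A).card + (S ∩ B).card = S.card := fun S hS => by
    rw [← Finset.card_union_of_disjoint
      (hdisj.mono Finset.inter_subset_right Finset.inter_subset_right),
      ← Finset.inter_union_distrib_left, Finset.inter_eq_left.2 hS]
  have hinter : ∀ S ⊆ A, ∀ T ⊆ B, (S ∪ T) ∩ A = S ∧ (S ∪ T) ∩ B = T := fun S hS T hT => by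
    rw [Finset.union_inter_distrib_right, Finset.union_inter_distrib_right,
      Finset.inter_eq_left.2 hS, Finset.inter_eq_left.2 hT,
      Finset.disjoint_iff_inter_eq_empty.1 (hdisj.symm.mono_left hT),
      Finset.disjoint_iff_inter_eq_empty.1 (hdisj.mono_left hS)]
    simp
  simp only [hookSum]
  rw [← Finset.sum_fiberwise_of_maps_to (t := Finset.HasAntidiagonal.antidiagonal k)
    (g := fun S => ((S ∩ A).card, (S ∩ B).card))]
  · refine Finset.sum_congr rfl fun p _ => ?_
    rw [Finset.sum_mul_sum, ← Finset.sum_product']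
    symm
    refine Finset.sum_nbij' (fun q => q.1 ∪ q.2) (fun S => (S ∩ A, S ∩ B)) ?_ ?_ ?_ ?_ ?_
    · rintro ⟨S, T⟩ h
      simp only [Finset.mem_product, mem_lowerSubsets, Finset.mem_filter] at h ⊢
      obtain ⟨⟨⟨hSA, hS⟩, hSl⟩, ⟨⟨hTB, hT⟩, hTl⟩⟩ := h
      have hd := hdisj.mono hSA hTB
      obtain ⟨h1, h2⟩ := hinter S hSA T hTB
      refine ⟨⟨⟨Finset.union_subset_union hSA hTB, ?_⟩, ?_⟩, by rw [h1, h2, hS, hT]⟩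
      · rw [Finset.card_union_of_disjoint hd, hS, hT]
        exact Finset.HasAntidiagonal.mem_antidiagonal.1 ‹_›
      · intro a ha b hb hab
        rcases Finset.mem_union.1 ha with ha | ha <;> rcases Finset.mem_union.1 hb with hb | hb
        · exact Finset.mem_union_left _ (hSl a ha b hb hab)
        · exact ((hAB a ha b (hTB hb)).1 hab).elim
        · exact ((hAB b (hSA hb) a ha).2 hab).elim
        · exact Finset.mem_union_right _ (hTl a ha b hb hab)
    · intro S h
      simp only [Finset.mem_product, mem_lowerSubsets, Finset.mem_filter] at h ⊢
      obtain ⟨⟨⟨hS, hk⟩, hl⟩, rfl⟩ := h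
      refine ⟨⟨⟨Finset.inter_subset_right, rfl⟩, fun a ha b hb hab => ?_⟩,
        ⟨⟨Finset.inter_subset_right, rfl⟩, fun a ha b hb hab => ?_⟩⟩
      · exact Finset.mem_inter.2 ⟨hl a (Finset.mem_union_left _ ha) b
          (Finset.mem_inter.1 hb).1 hab, ha⟩
      · exact Finset.mem_inter.2 ⟨hl a (Finset.mem_union_right _ ha) b
          (Finset.mem_inter.1 hb).1 hab, ha⟩
    · rintro ⟨S, T⟩ h
      simp only [Finset.mem_product, mem_lowerSubsets] at h
      obtain ⟨⟨⟨hSA, -⟩, -⟩, ⟨⟨hTB, -⟩, -⟩⟩ := h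
      exact Prod.ext (hinter S hSA T hTB).1 (hinter S hSA T hTB).2
    · intro S h
      simp only [mem_lowerSubsets, Finset.mem_filter] at h
      simp only [← Finset.inter_union_distrib_left, Finset.inter_eq_left.2 h.1.1.1]
    · rintro ⟨S, T⟩ h
      simp only [Finset.mem_product, mem_lowerSubsets] at h
      obtain ⟨⟨⟨hSA, -⟩, -⟩, ⟨⟨hTB, -⟩, -⟩⟩ := h
      dsimp only
      rw [Finset.prod_union (hdisj.mono hSA hTB)]
      congr 1
      · refine Finset.prod_congr rfl fun v hv => ?_
        rw [hookLength_union_left fun b hb => (hAB v (hSA hv) b hb).1,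
          hookLength_union_left fun b hb => (hAB v (hSA hv) b (hTB hb)).1]
      · refine Finset.prod_congr rfl fun v hv => ?_
        rw [hookLength_union_right fun a ha => (hAB a ha v (hTB hv)).2,
          hookLength_union_right fun a ha => (hAB a (hSA ha) v (hTB hv)).2]
  · intro S hS
    rw [mem_lowerSubsets] at hS
    rw [Finset.HasAntidiagonal.mem_antidiagonal, hcard S hS.1.1, hS.1.2]

/-- Adjoining a least element `r` to `F`. -/
lemma hookSum_insert_succ {F : Finset α} {r : α} (hr : ∀ a ∈ F, r < a) (i : ℕ) :
    hookSum (insert r F) (i + 1) = ((F.card + 1 : ℕ) : ℝ) / ((i + 1 : ℕ) : ℝ) * hookSum F i := by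
  have hrF : r ∉ F := fun h => lt_irrefl r (hr r h)
  have hhook : ∀ G : Finset α, ∀ v ∈ F, hookLength (insert r G) v = hookLength G v := by
    intro G v hv
    rw [Finset.insert_eq, hookLength_union_right]
    intro a ha
    rw [Finset.mem_singleton.1 ha]
    exact not_le_of_gt (hr v hv)
  have hroot : ∀ G ⊆ F, hookLength (insert r G) r = G.card + 1 := by
    intro G hG
    rw [hookLength_eq_card, Finset.card_insert_of_notMem fun h => hrF (hG h)]
    intro a ha
    rcases Finset.mem_insert.1 ha with rfl | ha
    · exact le_rfl
    · exact (hr a (hG ha)).le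
  have hmem : ∀ S ∈ lowerSubsets (insert r F) (i + 1), r ∈ S := by
    intro S hS
    obtain ⟨⟨hSF, hcard⟩, hl⟩ := mem_lowerSubsets.1 hS
    obtain ⟨b, hb⟩ : S.Nonempty := Finset.card_pos.1 (by omega)
    refine hl r (Finset.mem_insert_self r F) b hb ?_
    rcases Finset.mem_insert.1 (hSF hb) with rfl | h
    · exact le_rfl
    · exact (hr b h).le
  rw [hookSum, hookSum, Finset.mul_sum]
  symm
  refine Finset.sum_nbij' (fun S => insert r S) (fun S => S.erase r) ?_ ?_ ?_ ?_ ?_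
  · intro S hS
    obtain ⟨⟨hSF, hcard⟩, hl⟩ := mem_lowerSubsets.1 hS
    refine mem_lowerSubsets.2 ⟨⟨Finset.insert_subset_insert r hSF, ?_⟩, ?_⟩
    · rw [Finset.card_insert_of_notMem fun h => hrF (hSF h), hcard]
    · intro a ha b hb hab
      rcases Finset.mem_insert.1 ha with rfl | haF
      · exact Finset.mem_insert_self _ _
      · rcases Finset.mem_insert.1 hb with rfl | hb
        · exact (not_le_of_gt (hr a haF) hab).elim
        · exact Finset.mem_insert_of_mem (hl a haF b hb hab)
  · intro S hS
    have hrS := hmem S hS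
    obtain ⟨⟨hSF, hcard⟩, hl⟩ := mem_lowerSubsets.1 hS
    refine mem_lowerSubsets.2 ⟨⟨?_, ?_⟩, ?_⟩
    · rw [← Finset.erase_insert hrF]
      exact Finset.erase_subset_erase r hSF
    · rw [Finset.card_erase_of_mem hrS, hcard, Nat.add_sub_cancel]
    · intro a ha b hb hab
      exact Finset.mem_erase.2 ⟨(hr a ha).ne',
        hl a (Finset.mem_insert_of_mem ha) b (Finset.mem_of_mem_erase hb) hab⟩
  · intro S hS
    exact Finset.erase_insert fun h => hrF ((mem_lowerSubsets.1 hS).1.1 h)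
  · intro S hS
    exact Finset.insert_erase (hmem S hS)
  · intro S hS
    obtain ⟨⟨hSF, hcard⟩, -⟩ := mem_lowerSubsets.1 hS
    rw [Finset.prod_insert fun h => hrF (hSF h), hroot F subset_rfl, hroot S hSF, hcard]
    congr 1
    refine Finset.prod_congr rfl fun v hv => ?_
    rw [hhook F v (hSF hv), hhook S v (hSF hv)]

/-- In a rooted forest, hook sums of finite subsets are binomial coefficients. -/
theorem hookSum_eq_choose (hforest : ∀ v a b : α, a ≤ v → b ≤ v → a ≤ b ∨ b ≤ a)
    (F : Finset α) (i : ℕ) : hookSum F i = (F.card.choose i : ℝ) := by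
  induction F using Finset.strongInduction generalizing i with
  | H F ih =>
  rcases i with _ | i
  · simp [hookSum_zero]
  rcases F.eq_empty_or_nonempty with rfl | hF
  · have h : lowerSubsets (∅ : Finset α) (i + 1) = ∅ := by
      ext S
      simp only [mem_lowerSubsets, Finset.subset_empty, Finset.notMem_empty, iff_false]
      rintro ⟨⟨rfl, h⟩, -⟩
      simp at h
    simp [hookSum, h]
  obtain ⟨r, hr⟩ := F.exists_minimal hF
  by_cases htree : ∀ a ∈ F, r ≤ a
  · have hlt : ∀ a ∈ F.erase r, r < a := fun a ha =>
      lt_of_le_of_ne (htree a (Finset.mem_of_mem_erase ha)) (Finset.ne_of_mem_erase ha).symm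
    have hc := Finset.card_erase_add_one hr.prop
    have key := hookSum_insert_succ hlt i
    rw [Finset.insert_erase hr.prop, ih _ (Finset.erase_ssubset hr.prop)] at key
    rw [key, ← hc, div_mul_eq_mul_div, div_eq_iff (by positivity)]
    exact_mod_cast Nat.add_one_mul_choose_eq (F.erase r).card i
  · obtain ⟨c, hcF, hrc⟩ : ∃ c ∈ F, ¬ r ≤ c := by
      by_contra! h
      exact htree h
    have hsplit := Finset.filter_union_filter_not_eq (fun w => r ≤ w) F
    have hrel : ∀ a ∈ F.filter (fun w => r ≤ w), ∀ b ∈ F.filter (fun w => ¬ r ≤ w),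
        ¬ a ≤ b ∧ ¬ b ≤ a := by
      intro a ha b hb
      rw [Finset.mem_filter] at ha hb
      refine ⟨fun h => hb.2 (ha.2.trans h), fun h => ?_⟩
      rcases hforest a r b ha.2 h with h | h
      · exact hb.2 h
      · exact hb.2 (hr.le_of_le hb.1 h)
    have key := hookSum_union hrel (i + 1)
    rw [hsplit] at key
    rw [key, ← Finset.card_filter_add_card_filter_not (s := F) (fun w => r ≤ w),
      Nat.add_choose_eq, Nat.cast_sum]
    refine Finset.sum_congr rfl fun p _ => ?_
    rw [ih _ (Finset.filter_ssubset.2 ⟨c, hcF, hrc⟩),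
      ih _ (Finset.filter_ssubset.2 ⟨r, hr.prop, not_not.2 le_rfl⟩), Nat.cast_mul]

end

/-- **Hook-length identity for binomial coefficients on rooted forests.**  For a finite
rooted-forest poset `X` with `n` elements and `0 ≤ i ≤ n`:
`C(n, i) = ∑_S ∏_{v ∈ S} h_X(v)/h_S(v)`, the sum over all lower sets `S` of `X` with
`|S| = i`, where `h_X(v) = #{w : v ≤ w}` and `h_S(v) = #{w ∈ S : v ≤ w}`. -/
theorem forest_hook_binomial_identity (X : Type) [Fintype X] [PartialOrder X]
    (hforest : ∀ v a b : X, a ≤ v → b ≤ v → a ≤ b ∨ b ≤ a)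
    (i : ℕ) (hi : i ≤ Fintype.card X) :
    ((Fintype.card X).choose i : ℝ)
      = ∑ S ∈ Finset.univ.filter (fun S : Finset X =>
            S.card = i ∧ ∀ ⦃a b : X⦄, a ≤ b → b ∈ S → a ∈ S),
          ∏ v ∈ S,
            (((Finset.univ : Finset X).filter (fun w => v ≤ w)).card : ℝ) /
              ((S.filter (fun w => v ≤ w)).card : ℝ) := by
  rw [← Finset.card_univ, ← hookSum_eq_choose hforest Finset.univ i]
  refine Finset.sum_congr ?_ fun S _ => rfl
  ext S
  simp only [mem_lowerSubsets, Finset.mem_filter, Finset.mem_univ, Finset.subset_univ, true_and,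
    forall_const]
  exact and_congr_right fun _ => ⟨fun h a b hab hb => h a b hb hab, fun h a b hb hab => h hab hb⟩

end
end

section
/- Let j, r, i, i' be integers with r ≥ 0, 2r ≤ j, 0 ≤ i ≤ j and 0 ≤ i' ≤ j. Then, with the convention that the binomial coefficient C(a,b) equals 0 unless 0 ≤ b ≤ a: C(j−r, i)·C(j−r, i−r)·C(j−i, r+i'−i)·C(i, r−i'+i) = C(j−r, i')·C(j−r, i'−r)·C(j−i', r+i−i')·C(i', r−i+i'). (This identity expresses that π(ω_i) = C(j−r,i)·C(j−r,i−r) solves the detailed balance equations of the Markov chain that the top-and-bottom-r-to-random operator induces on the span of products of j degree-one primitives interleaved with one higher-degree primitive.) -/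
/-- The binomial coefficient extended to integer arguments:
`intChoose a b = C(a, b)` if `0 ≤ b ≤ a`, and `0` otherwise. -/
def intChoose (a b : ℤ) : ℤ :=
  if 0 ≤ b ∧ b ≤ a then (a.toNat).choose b.toNat else 0

theorem intChoose_of_not {a b : ℤ} (h : ¬(0 ≤ b ∧ b ≤ a)) : intChoose a b = 0 :=
  if_neg h

theorem intChoose_cast_eq_div {a b c : ℤ} (hb : 0 ≤ b) (hc : 0 ≤ c) (h : a = b + c) :
    (intChoose a b : ℚ) =
      (a.toNat.factorial : ℚ) / (b.toNat.factorial * c.toNat.factorial) := by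
  subst h
  rw [intChoose, if_pos ⟨hb, by omega⟩, Int.toNat_add hb hc, Int.cast_natCast,
    Nat.cast_add_choose]

/-- **Detailed-balance identity for the top-and-bottom-`r`-to-random chain.**
For integers `j, r, i, i'` with `r ≥ 0`, `2r ≤ j`, `0 ≤ i ≤ j`, `0 ≤ i' ≤ j`:
`C(j-r,i)C(j-r,i-r)C(j-i,r+i'-i)C(i,r-i'+i) = C(j-r,i')C(j-r,i'-r)C(j-i',r+i-i')C(i',r-i+i')`,
expressing that `π(ω_i) = C(j-r,i)C(j-r,i-r)` solves the detailed balance equations. -/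
theorem top_and_bottom_detailed_balance
    (j r i i' : ℤ) (hr : 0 ≤ r) (hj : 2 * r ≤ j)
    (hi0 : 0 ≤ i) (hij : i ≤ j) (hi'0 : 0 ≤ i') (hi'j : i' ≤ j) :
    intChoose (j - r) i * intChoose (j - r) (i - r) *
      intChoose (j - i) (r + i' - i) * intChoose i (r - i' + i)
    = intChoose (j - r) i' * intChoose (j - r) (i' - r) *
      intChoose (j - i') (r + i - i') * intChoose i' (r - i + i') := by
  by_cases h : (r ≤ i ∧ i ≤ j - r) ∧ (r ≤ i' ∧ i' ≤ j - r) ∧ 0 ≤ r + i' - i ∧ 0 ≤ r + i - i'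
  · obtain ⟨⟨h₁, h₂⟩, ⟨h₃, h₄⟩, h₅, h₆⟩ := h
    have key : ∀ n : ℕ, (n.factorial : ℚ) ≠ 0 := fun n => by
      exact_mod_cast n.factorial_ne_zero
    rw [show r - i' + i = r + i - i' by ring, show r - i + i' = r + i' - i by ring]
    apply Int.cast_injective (α := ℚ)
    push_cast
    rw [intChoose_cast_eq_div (a := j - r) (b := i) (c := j - r - i),
      intChoose_cast_eq_div (a := j - r) (b := i - r) (c := j - i),
      intChoose_cast_eq_div (a := j - i) (b := r + i' - i) (c := j - r - i'),
      intChoose_cast_eq_div (a := i) (b := r + i - i') (c := i' - r),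
      intChoose_cast_eq_div (a := j - r) (b := i') (c := j - r - i'),
      intChoose_cast_eq_div (a := j - r) (b := i' - r) (c := j - i'),
      intChoose_cast_eq_div (a := j - i') (b := r + i - i') (c := j - r - i),
      intChoose_cast_eq_div (a := i') (b := r + i' - i) (c := i - r)]
    · have := key i.toNat
      have := key i'.toNat
      have := key (j - i).toNat
      have := key (j - i').toNat
      have := key (i - r).toNat
      have := key (i' - r).toNat
      have := key (j - r - i).toNat
      have := key (j - r - i').toNat
      have := key (r + i' - i).toNat
      have := key (r + i - i').toNat
      field_simp
    all_goals omega
  · have vanish : ∀ x y : ℤ, ¬((r ≤ x ∧ x ≤ j - r) ∧ (r ≤ y ∧ y ≤ j - r) ∧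
        0 ≤ r + y - x ∧ 0 ≤ r + x - y) →
        intChoose (j - r) x * intChoose (j - r) (x - r) *
          intChoose (j - x) (r + y - x) * intChoose x (r - y + x) = 0 := by
      intro x y hxy
      by_cases ha : 0 ≤ x ∧ x ≤ j - r
      · by_cases hb : 0 ≤ x - r ∧ x - r ≤ j - r
        · by_cases hc : 0 ≤ r + y - x ∧ r + y - x ≤ j - x
          · rw [intChoose_of_not (a := x) (by omega), mul_zero]
          · rw [intChoose_of_not hc, mul_zero, zero_mul]
        · rw [intChoose_of_not hb, mul_zero, zero_mul, zero_mul]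
      · rw [intChoose_of_not ha, zero_mul, zero_mul, zero_mul]
    rw [vanish i i' h, vanish i' i (by omega)]
end

section
/- For every n ≥ 2 and every integer t ≥ 0: ∑_{σ ∈ S_n : σ_n < σ_{n−1}} (Ksh_n)^t(id, σ) = (1 − ((n−2)/n)^t)/2 (with the convention 0^0 = 1). That is, after t top-to-random shuffles of a deck of n distinct cards starting in ascending order, the probability that the bottommost card has lower value than the card immediately above it equals (1 − ((n−2)/n)^t)/2. -/
open scoped Classical

noncomputable section

/-- The standardisation (rank function) of a word `w = (w 0, …, w (m-1))` of distinct
letters from a linear order: position `a` is sent to the number of positions carrying a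
smaller letter (so, `0`-indexed ranks). -/
def std {m : ℕ} {α : Type*} [LinearOrder α] (w : Fin m → α) : Fin m → Fin m :=
  fun a =>
    ⟨(Finset.univ.filter (fun b => w b < w a)).card, by
      have ha : a ∉ Finset.univ.filter (fun b => w b < w a) := by simp
      have h := Finset.card_lt_card
        ((Finset.ssubset_iff_of_subset (Finset.filter_subset _ _)).2
          ⟨a, Finset.mem_univ a, ha⟩)
      simpa using h⟩

/-- The top-to-random shuffle transition matrix on `S_m`:  `Ksh m σ τ = 1/m` if deleting
the entry equal to `σ_1` (the top card) from the word `(τ_1, …, τ_m)` yields the word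
`(σ_2, …, σ_m)`, and `0` otherwise. -/
def Ksh (m : ℕ) : Matrix (Equiv.Perm (Fin m)) (Equiv.Perm (Fin m)) ℝ :=
  Matrix.of fun σ τ =>
    if ∀ i : Fin (m - 1),
        (if (i : ℕ) < ((τ.symm (σ ⟨0, by have := i.isLt; omega⟩)) : ℕ)
          then τ ⟨(i : ℕ), by have := i.isLt; omega⟩
          else τ ⟨(i : ℕ) + 1, by have := i.isLt; omega⟩)
          = σ ⟨(i : ℕ) + 1, by have := i.isLt; omega⟩
    then 1 / (m : ℝ) else 0


/-- A one-step transition is possible exactly when the top card is reinserted at its new position. -/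
theorem Ksh_apply (m : ℕ) (σ τ : Equiv.Perm (Fin (m + 2))) :
    Ksh (m + 2) σ τ =
      if τ = σ * (τ.symm (σ 0)).cycleRange then 1 / ((m + 2 : ℕ) : ℝ) else 0 := by
  unfold Ksh
  rw [Matrix.of_apply]
  refine if_congr ?_ rfl rfl
  have h0 : (⟨0, by omega⟩ : Fin (m + 2)) = 0 := rfl
  simp only [h0]
  set p := τ.symm (σ 0) with hp
  have hτp : τ p = σ 0 := by simp [hp]
  constructor
  · intro h
    ext1 j
    rw [Equiv.Perm.mul_apply]
    rcases lt_trichotomy j p with hj | hj | hj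
    · have hj' : (j : ℕ) < p := hj
      have hi := h ⟨j, by omega⟩
      rw [if_pos hj'] at hi
      rw [show p.cycleRange j = ⟨j + 1, by omega⟩ from
        Fin.ext (Fin.coe_cycleRange_of_lt hj)]
      exact hi
    · rw [hj, Fin.cycleRange_self, hτp]
    · have hj' : (p : ℕ) < j := hj
      have hi := h ⟨j - 1, by omega⟩
      rw [if_neg (by simp only; omega)] at hi
      have e : (⟨(j : ℕ) - 1 + 1, by omega⟩ : Fin (m + 2)) = j := Fin.ext (by simp only; omega)
      simp only [e] at hi
      rw [Fin.cycleRange_of_gt hj, hi]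
  · intro h i
    have hlt := i.isLt
    split_ifs with hi
    · rw [h, Equiv.Perm.mul_apply]
      congr 1
      exact Fin.ext (Fin.coe_cycleRange_of_lt hi)
    · rw [h, Equiv.Perm.mul_apply, Fin.cycleRange_of_gt]
      exact Fin.lt_def.2 (by simp only; omega)

/-- One step of the chain averages over the insertion positions of the top card. -/
theorem sum_Ksh_mul (m : ℕ) (σ : Equiv.Perm (Fin (m + 2)))
    (g : Equiv.Perm (Fin (m + 2)) → ℝ) :
    ∑ τ, Ksh (m + 2) σ τ * g τ =
      1 / ((m + 2 : ℕ) : ℝ) * ∑ p : Fin (m + 2), g (σ * p.cycleRange) := by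
  have key (p : Fin (m + 2)) : (σ * p.cycleRange).symm (σ 0) = p := by
    rw [Equiv.symm_apply_eq, Equiv.Perm.mul_apply, Fin.cycleRange_self]
  simp only [Ksh_apply, ite_mul, zero_mul]
  rw [← Finset.sum_filter, Finset.mul_sum]
  symm
  refine Finset.sum_bij (fun p _ => σ * p.cycleRange) ?_ ?_ ?_ ?_
  · intro p _
    simp [key]
  · intro p _ q _ h
    rw [← key p, h, key q]
  · intro τ hτ
    exact ⟨τ.symm (σ 0), Finset.mem_univ _, (Finset.mem_filter.1 hτ).2.symm⟩
  · intro p _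
    rfl

/-- The indicator that the bottom card is lower than the card immediately above it. -/
def bottomDescent (m : ℕ) (σ : Equiv.Perm (Fin (m + 2))) : ℝ :=
  if σ (Fin.last (m + 1)) < σ (Fin.last m).castSucc then 1 else 0

theorem sum_bottomDescent_mul_cycleRange (m : ℕ) (σ : Equiv.Perm (Fin (m + 2))) :
    ∑ p : Fin (m + 2), bottomDescent m (σ * p.cycleRange) = m * bottomDescent m σ + 1 := by
  rw [Fin.sum_univ_castSucc, Fin.sum_univ_castSucc]
  have h1 (i : Fin m) : bottomDescent m (σ * i.castSucc.castSucc.cycleRange) =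
      bottomDescent m σ := by
    unfold bottomDescent
    rw [Equiv.Perm.mul_apply, Equiv.Perm.mul_apply, Fin.cycleRange_of_gt,
      Fin.cycleRange_of_gt]
    · exact Fin.lt_def.2 (by simp)
    · exact Fin.lt_def.2 (by simp)
  have h2 : bottomDescent m (σ * (Fin.last m).castSucc.cycleRange) =
      if σ (Fin.last (m + 1)) < σ 0 then 1 else 0 := by
    unfold bottomDescent
    rw [Equiv.Perm.mul_apply, Equiv.Perm.mul_apply, Fin.cycleRange_of_gt (Fin.castSucc_lt_last _),
      Fin.cycleRange_self]
  have h3 : bottomDescent m (σ * (Fin.last (m + 1)).cycleRange) =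
      if σ 0 < σ (Fin.last (m + 1)) then 1 else 0 := by
    unfold bottomDescent
    rw [Equiv.Perm.mul_apply, Equiv.Perm.mul_apply, Fin.cycleRange_self,
      show (Fin.last (m + 1)).cycleRange (Fin.last m).castSucc = Fin.last (m + 1) from
        Fin.ext (by rw [Fin.coe_cycleRange_of_lt (Fin.castSucc_lt_last _)]; simp)]
  have hne : σ 0 ≠ σ (Fin.last (m + 1)) := by
    simp [Fin.ext_iff]
  simp only [h1, h2, h3, Finset.sum_const, Finset.card_univ, Fintype.card_fin, nsmul_eq_mul]
  rcases lt_or_gt_of_ne hne with h | h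
  · simp [h, h.not_gt]
  · simp [h, h.not_gt]

theorem sum_Ksh_pow_mul_bottomDescent (m t : ℕ) (σ : Equiv.Perm (Fin (m + 2))) :
    ∑ τ, (Ksh (m + 2) ^ t) σ τ * bottomDescent m τ =
      1 / 2 + ((m : ℝ) / (m + 2)) ^ t * (bottomDescent m σ - 1 / 2) := by
  induction t generalizing σ with
  | zero => simp [Matrix.one_apply]
  | succ t ih =>
    have hstep : ∑ τ, (Ksh (m + 2) ^ (t + 1)) σ τ * bottomDescent m τ =
        ∑ ρ, Ksh (m + 2) σ ρ * ∑ τ, (Ksh (m + 2) ^ t) ρ τ * bottomDescent m τ := by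
      simp only [pow_succ', Matrix.mul_apply, Finset.sum_mul, Finset.mul_sum, mul_assoc]
      exact Finset.sum_comm
    rw [hstep]
    simp only [ih]
    rw [sum_Ksh_mul, Finset.sum_add_distrib, ← Finset.mul_sum, Finset.sum_sub_distrib,
      sum_bottomDescent_mul_cycleRange]
    simp only [Finset.sum_const, Finset.card_univ, Fintype.card_fin, nsmul_eq_mul]
    have hm : (m : ℝ) + 2 ≠ 0 := by positivity
    push_cast
    rw [pow_succ]
    generalize ((m : ℝ) / (m + 2)) ^ t = r
    field_simp
    ring

/-- **After `t` top-to-random shuffles of a deck of `n` distinct cards starting in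
ascending order, the probability that the bottommost card has lower value than the card
immediately above it equals `(1 - ((n-2)/n)^t)/2`** (with the convention `0^0 = 1`). -/
theorem topToRandom_bottom_two_cards_probability (n : ℕ) (hn : 2 ≤ n) (t : ℕ) :
    ∑ σ ∈ Finset.univ.filter (fun σ : Equiv.Perm (Fin n) =>
        σ ⟨n - 1, by omega⟩ < σ ⟨n - 2, by omega⟩),
      (Ksh n ^ t) 1 σ
    = (1 - (((n : ℝ) - 2) / (n : ℝ)) ^ t) / 2 := by
  obtain ⟨m, rfl⟩ := Nat.exists_eq_add_of_le' hn
  have h := sum_Ksh_pow_mul_bottomDescent m t 1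
  have h1 : bottomDescent m 1 = 0 := by
    simp [bottomDescent, Fin.lt_def]
  rw [h1] at h
  rw [Finset.sum_filter]
  have hr : ((m + 2 : ℕ) : ℝ) - 2 = m := by push_cast; ring
  rw [hr]
  push_cast
  trans 1 / 2 + ((m : ℝ) / (m + 2)) ^ t * (0 - 1 / 2)
  · rw [← h]
    refine Finset.sum_congr rfl fun τ _ => ?_
    rw [bottomDescent, mul_ite, mul_one, mul_zero]
    rfl
  · ring

end
end
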